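/- arXiv:1502.02842 — 2 statements merged into one kernel-verified Lean document; each statement's English description precedes it below -/
import Mathlib

section
/- For every n ≥ 1, the dual cone of the completely positive semidefinite cone equals the intersection of the polyhedral cones D_r^n: CS+^{n*} = ⋂_{r ≥ 1} D_r^n. -/
open Matrix

/-- The completely positive semidefinite cone `CS+^n`. -/
def IsCSPlus {n : ℕ} (A : Matrix (Fin n) (Fin n) ℝ) : Prop :=
  ∃ d : ℕ, 1 ≤ d ∧ ∃ X : Fin n → Matrix (Fin d) (Fin d) ℝ,
    (∀ i, (X i).PosSemidef) ∧ ∀ i j, A i j = (X i * X j).trace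

/-- A real number is rational with denominator at most `r`. -/
def RatDen (r : ℕ) (x : ℝ) : Prop :=
  ∃ (p : ℤ) (q : ℕ), 1 ≤ q ∧ q ≤ r ∧ x = (p : ℝ) / (q : ℝ)

/-- Membership in the cone `D_r^n`. -/
def InD (n r : ℕ) (M : Matrix (Fin n) (Fin n) ℝ) : Prop :=
  ∀ d : ℕ, 1 ≤ d → ∀ X : Fin n → Matrix (Fin d) (Fin d) ℝ,
    (∀ i, (X i).PosSemidef) → (∑ i, (X i).trace) = 1 →
    (∀ i k l, RatDen r (X i k l)) →
    0 ≤ ∑ i, ∑ j, M i j * (X i * X j).trace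

/-- Finitely many rational numbers have a common bound on their denominators. -/
lemma exists_ratDen_bound {ι : Type*} [Finite ι] (y : ι → ℚ) :
    ∃ r : ℕ, 1 ≤ r ∧ ∀ a, RatDen r (y a : ℝ) := by
  have := Fintype.ofFinite ι
  refine ⟨Finset.univ.sup (fun a => (y a).den) + 1, by omega, fun a =>
    ⟨(y a).num, (y a).den, (y a).den_pos, ?_, Rat.cast_def _⟩⟩
  exact (Finset.le_sup (f := fun a => (y a).den) (Finset.mem_univ a)).trans (Nat.le_succ _)

/-- A matrix in every `D_r^n` has nonnegative form on tuples of rational positive semidefinite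
matrices, without normalization of the trace. -/
lemma form_nonneg_of_rational {n d : ℕ} (hd : 1 ≤ d) {M : Matrix (Fin n) (Fin n) ℝ}
    (hM : ∀ r, 1 ≤ r → InD n r M) (Y : Fin n → Matrix (Fin d) (Fin d) ℚ)
    (hY : ∀ i, ((Y i).map (Rat.cast : ℚ → ℝ)).PosSemidef) :
    0 ≤ ∑ i, ∑ j, M i j *
      ((Y i).map (Rat.cast : ℚ → ℝ) * (Y j).map (Rat.cast : ℚ → ℝ)).trace := by
  set X : Fin n → Matrix (Fin d) (Fin d) ℝ := fun i => (Y i).map (Rat.cast : ℚ → ℝ) with hX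
  set t : ℚ := ∑ i, (Y i).trace with ht
  have htX : (t : ℝ) = ∑ i, (X i).trace := by
    simp [ht, hX, Matrix.trace]
  have hnonneg : ∀ i ∈ Finset.univ, 0 ≤ (X i).trace := fun i _ => (hY i).trace_nonneg
  rcases eq_or_ne t 0 with h0 | h0
  · rw [h0, Rat.cast_zero, eq_comm, Finset.sum_eq_zero_iff_of_nonneg hnonneg] at htX
    have hX0 : ∀ i, X i = 0 := fun i =>
      (hY i).trace_eq_zero_iff.mp (htX i (Finset.mem_univ i))
    change 0 ≤ ∑ i, ∑ j, M i j * (X i * X j).trace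
    simp [hX0]
  · have htpos : 0 < (t : ℝ) :=
      lt_of_le_of_ne (htX ▸ Finset.sum_nonneg hnonneg) (by exact_mod_cast h0.symm)
    obtain ⟨r, hr, hden⟩ := exists_ratDen_bound
      (fun a : Fin n × Fin d × Fin d => t⁻¹ * Y a.1 a.2.1 a.2.2)
    have key := hM r hr d hd (fun i => (t : ℝ)⁻¹ • X i)
      (fun i => (hY i).smul (inv_nonneg.mpr htpos.le))
      (by simp only [Matrix.trace_smul, smul_eq_mul, ← Finset.mul_sum, ← htX]
          exact inv_mul_cancel₀ htpos.ne')
      (fun i k l => by simpa [hX] using hden (i, k, l))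
    have hscale : ∑ i, ∑ j, M i j * (((t : ℝ)⁻¹ • X i) * ((t : ℝ)⁻¹ • X j)).trace =
        ((t : ℝ)⁻¹ * (t : ℝ)⁻¹) * ∑ i, ∑ j, M i j * (X i * X j).trace := by
      simp only [Finset.mul_sum, Matrix.smul_mul, Matrix.mul_smul, Matrix.trace_smul, smul_eq_mul]
      exact Finset.sum_congr rfl fun i _ => Finset.sum_congr rfl fun j _ => by ring
    rw [hscale] at key
    exact nonneg_of_mul_nonneg_right key (by positivity)

/-- Nonnegativity of the form on Gram tuples `Bᵢᵀ Bᵢ`, by density of the rational matrices. -/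
lemma form_nonneg_of_gram {n d : ℕ} (hd : 1 ≤ d) {M : Matrix (Fin n) (Fin n) ℝ}
    (hM : ∀ r, 1 ≤ r → InD n r M) (B : Fin n → Matrix (Fin d) (Fin d) ℝ) :
    0 ≤ ∑ i, ∑ j, M i j * (((B i)ᵀ * B i) * ((B j)ᵀ * B j)).trace := by
  have hdense : DenseRange (fun (Q : Fin n → Matrix (Fin d) (Fin d) ℚ) i =>
      (Q i).map (Rat.cast : ℚ → ℝ)) :=
    DenseRange.piMap fun _ => DenseRange.piMap fun _ => DenseRange.piMap fun _ =>
      Rat.denseRange_cast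
  refine hdense.induction_on (p := fun B : Fin n → Matrix (Fin d) (Fin d) ℝ =>
    0 ≤ ∑ i, ∑ j, M i j * (((B i)ᵀ * B i) * ((B j)ᵀ * B j)).trace) B ?_ fun Q => ?_
  · exact isClosed_le continuous_const (by fun_prop)
  · have hcast : ∀ i, ((Q i)ᵀ * Q i).map (Rat.cast : ℚ → ℝ) =
        ((Q i).map (Rat.cast : ℚ → ℝ))ᵀ * (Q i).map (Rat.cast : ℚ → ℝ) := fun i => by
      ext k l
      simp [Matrix.mul_apply]
    have key := form_nonneg_of_rational hd hM (fun i => (Q i)ᵀ * Q i) fun i => by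
      rw [hcast, ← Matrix.conjTranspose_eq_transpose_of_trivial]
      exact Matrix.posSemidef_conjTranspose_mul_self _
    simpa only [hcast] using key

open scoped MatrixOrder Matrix.Norms.L2Operator in
/-- A real positive semidefinite matrix is a Gram matrix. -/
lemma exists_eq_transpose_mul_self {d : ℕ} {X : Matrix (Fin d) (Fin d) ℝ} (hX : X.PosSemidef) :
    ∃ B : Matrix (Fin d) (Fin d) ℝ, X = Bᵀ * B := by
  obtain ⟨B, hB⟩ := CStarAlgebra.nonneg_iff_eq_star_mul_self.mp hX.nonneg
  exact ⟨B, by rw [hB, Matrix.star_eq_conjTranspose,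
    Matrix.conjTranspose_eq_transpose_of_trivial]⟩

/-- The trace pairing with a symmetric matrix as an entrywise sum. -/
lemma trace_mul_eq_sum {n : ℕ} {M : Matrix (Fin n) (Fin n) ℝ} (hM : M.IsSymm)
    (A : Matrix (Fin n) (Fin n) ℝ) : (A * M).trace = ∑ i, ∑ j, M i j * A i j := by
  simp only [Matrix.trace, Matrix.diag, Matrix.mul_apply]
  exact Finset.sum_congr rfl fun i _ => Finset.sum_congr rfl fun j _ => by
    rw [hM.apply i j, mul_comm]

/-- The dual cone `CS+^{n*}` equals the intersection of the polyhedral cones `D_r^n`, `r ≥ 1`. -/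
theorem stmt5 (n : ℕ) (hn : 1 ≤ n) :
    {M : Matrix (Fin n) (Fin n) ℝ | M.IsSymm ∧ ∀ A, IsCSPlus A → 0 ≤ (A * M).trace} =
    ⋂ r ∈ {r : ℕ | 1 ≤ r}, {M : Matrix (Fin n) (Fin n) ℝ | M.IsSymm ∧ InD n r M} := by
  ext M
  simp only [Set.mem_iInter, Set.mem_ofPred_eq]
  constructor
  · rintro ⟨hs, hM⟩ r -
    refine ⟨hs, fun d hd X hX _ _ => ?_⟩
    have key := hM (Matrix.of fun i j => (X i * X j).trace) ⟨d, hd, X, hX, fun _ _ => rfl⟩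
    rwa [trace_mul_eq_sum hs] at key
  · intro hM
    have hs : M.IsSymm := (hM 1 le_rfl).1
    refine ⟨hs, ?_⟩
    rintro A ⟨d, hd, X, hX, hA⟩
    choose B hB using fun i => exists_eq_transpose_mul_self (hX i)
    rw [trace_mul_eq_sum hs]
    simp only [hA, hB]
    exact form_nonneg_of_gram hd (fun r hr => (hM r hr).2) B
end

section
/- For every n ≥ 2 and r ≥ 1, the inclusions C_r^n ⊆ C_{r+1}^n ⊆ CS+^n are strict: C_r^n ⊊ C_{r+1}^n ⊊ CS+^n. -/
open Matrix

/-- Membership in `Δ̲(n,r)`. -/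
def InUDelta (n r : ℕ) (X : Fin n → Matrix (Fin r) (Fin r) ℝ) : Prop :=
  (∀ i, (X i).PosSemidef) ∧ (∑ i, (X i).trace) = 1 ∧ ∀ i k l, RatDen r (X i k l)

/-- The Gram matrix `(Tr(X_i X_j))_{i,j}` of a tuple of matrices. -/
def gramMat {n r : ℕ} (X : Fin n → Matrix (Fin r) (Fin r) ℝ) : Matrix (Fin n) (Fin n) ℝ :=
  Matrix.of fun i j => (X i * X j).trace

/-- The cone `C_r^n`: all finite nonnegative linear combinations of Gram matrices of tuples
in `Δ̲(n,r)`. -/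
def InC (n r : ℕ) (A : Matrix (Fin n) (Fin n) ℝ) : Prop :=
  ∃ (m : ℕ) (c : Fin m → ℝ) (X : Fin m → Fin n → Matrix (Fin r) (Fin r) ℝ),
    (∀ k, 0 ≤ c k) ∧ (∀ k, InUDelta n r (X k)) ∧ A = ∑ k, c k • gramMat (X k)

/-- The block diagonal matrix with blocks `A` and `B`, indexed by `Fin (d + e)`. -/
def directSumFin {d e : ℕ} (A : Matrix (Fin d) (Fin d) ℝ) (B : Matrix (Fin e) (Fin e) ℝ) :
    Matrix (Fin (d + e)) (Fin (d + e)) ℝ :=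
  (fromBlocks A 0 0 B).submatrix finSumFinEquiv.symm finSumFinEquiv.symm

lemma posSemidef_fromBlocks_diag {l m : Type*} [Fintype l] [Fintype m] {A : Matrix l l ℝ}
    {B : Matrix m m ℝ} (hA : A.PosSemidef) (hB : B.PosSemidef) :
    (fromBlocks A 0 0 B).PosSemidef := by
  refine PosSemidef.of_dotProduct_mulVec_nonneg
    (IsHermitian.fromBlocks hA.1 (by simp) hB.1) fun x => ?_
  rw [← Sum.elim_comp_inl_inr x, fromBlocks_mulVec, star_trivial, sumElim_dotProduct_sumElim]
  simpa using add_nonneg (hA.dotProduct_mulVec_nonneg (x ∘ Sum.inl))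
    (hB.dotProduct_mulVec_nonneg (x ∘ Sum.inr))

lemma posSemidef_directSumFin {d e : ℕ} {A : Matrix (Fin d) (Fin d) ℝ}
    {B : Matrix (Fin e) (Fin e) ℝ} (hA : A.PosSemidef) (hB : B.PosSemidef) :
    (directSumFin A B).PosSemidef :=
  (posSemidef_fromBlocks_diag hA hB).submatrix _

lemma trace_directSumFin {d e : ℕ} (A : Matrix (Fin d) (Fin d) ℝ)
    (B : Matrix (Fin e) (Fin e) ℝ) : (directSumFin A B).trace = A.trace + B.trace := by
  simp [directSumFin, trace, Fin.sum_univ_add]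

lemma directSumFin_mul {d e : ℕ} (A A' : Matrix (Fin d) (Fin d) ℝ)
    (B B' : Matrix (Fin e) (Fin e) ℝ) :
    directSumFin A B * directSumFin A' B' = directSumFin (A * A') (B * B') := by
  simp [directSumFin, submatrix_mul_equiv, fromBlocks_multiply]

lemma IsCSPlus.zero {n : ℕ} : IsCSPlus (0 : Matrix (Fin n) (Fin n) ℝ) :=
  ⟨1, le_rfl, fun _ => 0, fun _ => PosSemidef.zero, by simp⟩

lemma IsCSPlus.add {n : ℕ} {A B : Matrix (Fin n) (Fin n) ℝ} (hA : IsCSPlus A)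
    (hB : IsCSPlus B) : IsCSPlus (A + B) := by
  obtain ⟨d, hd, X, hX, hAX⟩ := hA
  obtain ⟨e, -, Y, hY, hBY⟩ := hB
  exact ⟨d + e, by omega, fun i => directSumFin (X i) (Y i),
    fun i => posSemidef_directSumFin (hX i) (hY i),
    fun i j => by simp [directSumFin_mul, trace_directSumFin, hAX, hBY]⟩

lemma IsCSPlus.smul {n : ℕ} {A : Matrix (Fin n) (Fin n) ℝ} (hA : IsCSPlus A) {c : ℝ}
    (hc : 0 ≤ c) : IsCSPlus (c • A) := by
  obtain ⟨d, hd, X, hX, hAX⟩ := hA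
  refine ⟨d, hd, fun i => √c • X i, fun i => (hX i).smul (Real.sqrt_nonneg c), fun i j => ?_⟩
  simp [hAX, ← mul_assoc, Real.mul_self_sqrt hc]

lemma InC.isCSPlus {n r : ℕ} (hr : 1 ≤ r) {A : Matrix (Fin n) (Fin n) ℝ} (hA : InC n r A) :
    IsCSPlus A := by
  obtain ⟨m, c, X, hc, hX, rfl⟩ := hA
  refine Finset.sum_induction _ IsCSPlus (fun _ _ => IsCSPlus.add) IsCSPlus.zero fun k _ => ?_
  exact IsCSPlus.smul ⟨r, hr, X k, (hX k).1, fun _ _ => rfl⟩ (hc k)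

lemma ratDen_zero {r : ℕ} (hr : 1 ≤ r) : RatDen r 0 := ⟨0, 1, le_rfl, hr, by simp⟩

lemma RatDen.succ {r : ℕ} {x : ℝ} (hx : RatDen r x) : RatDen (r + 1) x := by
  obtain ⟨p, q, hq, hqr, h⟩ := hx
  exact ⟨p, q, hq, by omega, h⟩

lemma InUDelta.directSumFin_zero {n r : ℕ} {X : Fin n → Matrix (Fin r) (Fin r) ℝ}
    (hX : InUDelta n r X) :
    InUDelta n (r + 1) fun i => directSumFin (X i) (0 : Matrix (Fin 1) (Fin 1) ℝ) := by
  obtain ⟨hpsd, htr, hrat⟩ := hX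
  refine ⟨fun i => posSemidef_directSumFin (hpsd i) PosSemidef.zero, ?_, fun i k l => ?_⟩
  · simpa [trace_directSumFin] using htr
  · have h0 : RatDen (r + 1) 0 := ratDen_zero (by omega)
    change RatDen (r + 1) (fromBlocks (X i) 0 0 (0 : Matrix (Fin 1) (Fin 1) ℝ)
      (finSumFinEquiv.symm k) (finSumFinEquiv.symm l))
    rcases finSumFinEquiv.symm k with k | k <;> rcases finSumFinEquiv.symm l with l | l
    · exact (hrat i k l).succ
    all_goals exact h0

lemma InC.succ {n r : ℕ} {A : Matrix (Fin n) (Fin n) ℝ} (hA : InC n r A) :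
    InC n (r + 1) A := by
  obtain ⟨m, c, X, hc, hX, rfl⟩ := hA
  refine ⟨m, c, fun k i => directSumFin (X k i) (0 : Matrix (Fin 1) (Fin 1) ℝ), hc,
    fun k => (hX k).directSumFin_zero, ?_⟩
  refine Finset.sum_congr rfl fun k _ => ?_
  congr 1
  ext i j
  simp [gramMat, directSumFin_mul, trace_directSumFin]

/-- A positive number that is rational with denominator at most `r` is at least `1 / r`. -/
lemma RatDen.one_le_mul {r : ℕ} {x : ℝ} (hx : RatDen r x) (hpos : 0 < x) : 1 ≤ r * x := by
  obtain ⟨p, q, hq, hqr, rfl⟩ := hx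
  have hq' : (0 : ℝ) < q := by exact_mod_cast hq
  have hp : (1 : ℝ) ≤ p := by
    have : (0 : ℝ) < p := (div_pos_iff_of_pos_right hq').1 hpos
    exact_mod_cast this
  have hqr' : (q : ℝ) ≤ r := by exact_mod_cast hqr
  rw [← mul_div_assoc, le_div_iff₀ hq']
  nlinarith

lemma one_le_mul_trace_of_ratDen {r : ℕ} {M : Matrix (Fin r) (Fin r) ℝ} (hM : M.PosSemidef)
    (hrat : ∀ k l, RatDen r (M k l)) (hpos : 0 < M.trace) : 1 ≤ r * M.trace := by
  obtain ⟨k, -, hk⟩ := Finset.exists_lt_of_sum_lt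
    (s := Finset.univ) (f := fun _ => (0 : ℝ)) (g := fun k => M k k) (by simpa [trace] using hpos)
  have hle : M k k ≤ M.trace :=
    Finset.single_le_sum (f := fun k => M k k) (fun _ _ => hM.diag_nonneg) (Finset.mem_univ k)
  exact ((hrat k k).one_le_mul hk).trans (by gcongr)

lemma trace_sq_smul_sub_smul {d : ℕ} (M N : Matrix (Fin d) (Fin d) ℝ) (a b : ℝ) :
    ((a • M - b • N) * (a • M - b • N)).trace =
      a ^ 2 * (M * M).trace - 2 * a * b * (N * M).trace + b ^ 2 * (N * N).trace := by
  simp only [sub_mul, mul_sub, trace_sub, smul_mul_assoc, mul_smul_comm, trace_smul, smul_eq_mul,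
    trace_mul_comm M N]
  ring

/-- If `v vᵀ` lies in `C_r^n` with `∑ i, v i = 1`, then a positive coordinate of `v` is at least
`1 / r`. -/
lemma InC.one_le_mul_of_vecMulVec {n r : ℕ} {v : Fin n → ℝ} (hA : InC n r (vecMulVec v v))
    (hv : ∑ i, v i = 1) {z : Fin n} (hz : 0 < v z) : 1 ≤ r * v z := by
  obtain ⟨m, c, X, hc, hX, hA⟩ := hA
  have hent (i j : Fin n) : v i * v j = ∑ k, c k * (X k i * X k j).trace := by
    simpa [vecMulVec_apply, Matrix.sum_apply, gramMat] using congrFun (congrFun hA i) j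
  obtain ⟨k, hk⟩ : ∃ k, 0 < c k := by
    by_contra! h
    have := hent z z
    simp [fun k => le_antisymm (h k) (hc k)] at this
    exact hz.ne' this
  obtain ⟨hpsd, htr, hrat⟩ := hX k
  have hherm (k : Fin m) (i : Fin n) :
      (v z • X k i - v i • X k z)ᴴ = v z • X k i - v i • X k z := by
    rw [conjTranspose_sub, conjTranspose_smul, conjTranspose_smul, ((hX k).1 i).1.eq,
      ((hX k).1 z).1.eq, star_trivial, star_trivial]
  have hsq (k : Fin m) (i : Fin n) :
      0 ≤ ((v z • X k i - v i • X k z) * (v z • X k i - v i • X k z)).trace := by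
    have := (posSemidef_conjTranspose_mul_self (v z • X k i - v i • X k z)).trace_nonneg
    rwa [hherm] at this
  have hpar (i : Fin n) : v z • X k i = v i • X k z := by
    have hsum : ∑ k, c k * ((v z • X k i - v i • X k z) * (v z • X k i - v i • X k z)).trace
        = 0 := by
      calc _ = v z ^ 2 * ∑ k, c k * (X k i * X k i).trace
            - 2 * v z * v i * ∑ k, c k * (X k z * X k i).trace
            + v i ^ 2 * ∑ k, c k * (X k z * X k z).trace := by
            simp only [Finset.mul_sum, ← Finset.sum_sub_distrib, ← Finset.sum_add_distrib]
            refine Finset.sum_congr rfl fun k _ => ?_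
            rw [trace_sq_smul_sub_smul]
            ring
        _ = 0 := by
            rw [← hent, ← hent, ← hent]
            ring
    have h0 := (Finset.sum_eq_zero_iff_of_nonneg
      fun k _ => mul_nonneg (hc k) (hsq k i)).1 hsum k (Finset.mem_univ k)
    have h1 := (mul_eq_zero.1 h0).resolve_left hk.ne'
    nth_rewrite 1 [← hherm] at h1
    exact sub_eq_zero.1 (trace_conjTranspose_mul_self_eq_zero_iff.1 h1)
  have htrz : (X k z).trace = v z := by
    calc (X k z).trace = ∑ i, (v i • X k z).trace := by
          simp only [trace_smul, smul_eq_mul, ← Finset.sum_mul, hv, one_mul]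
      _ = v z * ∑ i, (X k i).trace := by
          simp only [← hpar, trace_smul, smul_eq_mul, Finset.mul_sum]
      _ = v z := by rw [htr, mul_one]
  rw [← htrz]
  exact one_le_mul_trace_of_ratDen (hpsd z) (hrat z) (htrz ▸ hz)

lemma inC_vecMulVec {n r : ℕ} {v : Fin n → ℝ} (h0 : ∀ i, 0 ≤ v i) (hv : ∑ i, v i = 1)
    (hrat : ∀ i, RatDen (r + 1) (v i)) : InC n (r + 1) (vecMulVec v v) := by
  refine ⟨1, 1, fun _ i => diagonal (Pi.single 0 (v i)), by simp,
    fun _ => ⟨fun i => ?_, ?_, ?_⟩, ?_⟩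
  · rw [posSemidef_diagonal_iff]
    have hnonneg : 0 ≤ (Pi.single 0 (v i) : Fin (r + 1) → ℝ) := Pi.single_nonneg.2 (h0 i)
    exact fun k => hnonneg k
  · simpa using hv
  · intro i k l
    have hzero : RatDen (r + 1) 0 := ratDen_zero (by omega)
    change RatDen (r + 1) (diagonal (Pi.single 0 (v i)) k l)
    rw [diagonal_apply, Pi.single_apply]
    split_ifs
    exacts [hrat i, hzero, hzero]
  · ext i j
    simp [gramMat, vecMulVec_apply, Pi.single_apply]

lemma exists_inC_succ_not_inC {n : ℕ} (hn : 2 ≤ n) (r : ℕ) :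
    ∃ A : Matrix (Fin n) (Fin n) ℝ, InC n (r + 1) A ∧ ¬ InC n r A := by
  obtain ⟨m, rfl⟩ := Nat.exists_eq_add_of_le' hn
  have hr : (0 : ℝ) < r + 1 := by positivity
  let v : Fin (m + 2) → ℝ := Fin.cons (1 / (r + 1)) (Fin.cons (r / (r + 1)) 0)
  have hv : ∑ i, v i = 1 := by
    simp [v, Fin.sum_univ_succ]
    field_simp
    ring
  refine ⟨vecMulVec v v, inC_vecMulVec ?_ hv ?_, fun h => ?_⟩
  · refine Fin.cases ?_ (Fin.cases ?_ fun i => ?_) <;> simp [v] <;> positivity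
  · refine Fin.cases ?_ (Fin.cases ?_ fun i => ?_)
    · exact ⟨1, r + 1, by omega, le_rfl, by simp [v]⟩
    · exact ⟨r, r + 1, by omega, le_rfl, by simp [v]⟩
    · exact ratDen_zero (by omega)
  · have h1 := h.one_le_mul_of_vecMulVec hv (z := 0) (by simp only [v, Fin.cons_zero]; positivity)
    simp only [v, Fin.cons_zero, mul_one_div, le_div_iff₀ hr] at h1
    linarith

/-- For `n ≥ 2` and `r ≥ 1` the inclusions `C_r^n ⊊ C_{r+1}^n ⊊ CS+^n` are strict. -/
theorem stmt7 (n r : ℕ) (hn : 2 ≤ n) (hr : 1 ≤ r) :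
    {A : Matrix (Fin n) (Fin n) ℝ | InC n r A} ⊂ {A | InC n (r + 1) A} ∧
    {A : Matrix (Fin n) (Fin n) ℝ | InC n (r + 1) A} ⊂ {A | IsCSPlus A} := by
  obtain ⟨A, hA, hA'⟩ := exists_inC_succ_not_inC hn r
  obtain ⟨B, hB, hB'⟩ := exists_inC_succ_not_inC hn (r + 1)
  exact ⟨⟨fun _ h => h.succ, fun h => hA' (h hA)⟩,
    ⟨fun _ h => h.isCSPlus (by omega), fun h => hB' (h (hB.isCSPlus (by omega)))⟩⟩
end
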